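/- (Proposition 1.2, contact-form part) Fix null vectors w₀, w₃ ∈ ℂ⁴ with ⟨w₀, w₃⟩ = i, and let Q̂(t, z) = z + w₀ − (i/2)·⟨z, z⟩·w₃ + t·w₃ for (t, z) ∈ ℝ × 𝔼. For every (t, z) ∈ ℝ × 𝔼 and every tangent vector (ṫ, ż) ∈ ℝ × 𝔼, the derivative of Q̂ at (t, z) in the direction (ṫ, ż) equals v = ż + (ṫ − i·Re⟨ż, z⟩)·w₃, and this vector satisfies i·⟨v, Q̂(t, z)⟩ = ṫ − Im⟨ż, z⟩. (Thus Q̂ pulls the contact form i·⟨dw, w⟩ of Σ_{w₃} back to the standard contact form dt + (i/2)·(⟨dz, z⟩ − ⟨z, dz⟩) of ℝ ⊕ 𝔼.) -/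

import Mathlib

open Complex ComplexConjugate

/-- The Hermitian form of signature (3,1) on `ℂ⁴`. -/
noncomputable def herm (z w : Fin 4 → ℂ) : ℂ :=
  z 1 * conj (w 1) + z 2 * conj (w 2) + Complex.I * (z 0 * conj (w 3) - z 3 * conj (w 0))

/-- The map `Q̂(t, z) = z + w₀ − (i/2)·⟨z, z⟩·w₃ + t·w₃`. -/
noncomputable def Qhat (w₀ w₃ : Fin 4 → ℂ) (t : ℝ) (z : Fin 4 → ℂ) : Fin 4 → ℂ :=
  z + w₀ - (Complex.I / 2 * herm z z) • w₃ + (t : ℂ) • w₃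

theorem herm_add_left (a b c : Fin 4 → ℂ) : herm (a + b) c = herm a c + herm b c := by
  simp only [herm, Pi.add_apply]; ring

theorem herm_smul_left (k : ℂ) (a c : Fin 4 → ℂ) : herm (k • a) c = k * herm a c := by
  simp only [herm, Pi.smul_apply, smul_eq_mul]; ring

theorem herm_conj (a b : Fin 4 → ℂ) : conj (herm a b) = herm b a := by
  simp only [herm, map_add, map_mul, map_sub, Complex.conj_conj, Complex.conj_I]; ring

theorem herm_add_right (a b c : Fin 4 → ℂ) : herm c (a + b) = herm c a + herm c b := by
  simp only [herm, Pi.add_apply, map_add]; ring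

theorem herm_smul_right (k : ℂ) (a c : Fin 4 → ℂ) : herm c (k • a) = conj k * herm c a := by
  simp only [herm, Pi.smul_apply, smul_eq_mul, map_mul]; ring

/-- Proposition 1.2 (contact-form part): the derivative of `Q̂` at `(t, z)` in the
direction `(ṫ, ż)` equals `v = ż + (ṫ − i·Re⟨ż, z⟩)·w₃`, and
`i·⟨v, Q̂(t, z)⟩ = ṫ − Im⟨ż, z⟩`. -/
theorem stmt_7 (w₀ w₃ : Fin 4 → ℂ) (h₀ : herm w₀ w₀ = 0) (h₃ : herm w₃ w₃ = 0)
    (h₀₃ : herm w₀ w₃ = Complex.I)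
    (t : ℝ) (z : Fin 4 → ℂ) (hz₀ : herm z w₀ = 0) (hz₃ : herm z w₃ = 0)
    (tdot : ℝ) (zdot : Fin 4 → ℂ) (hzdot₀ : herm zdot w₀ = 0) (hzdot₃ : herm zdot w₃ = 0) :
    HasDerivAt (fun s : ℝ => Qhat w₀ w₃ (t + s * tdot) (z + s • zdot))
      (zdot + ((tdot : ℂ) - Complex.I * ((herm zdot z).re : ℂ)) • w₃) 0 ∧
    Complex.I * herm (zdot + ((tdot : ℂ) - Complex.I * ((herm zdot z).re : ℂ)) • w₃)
        (Qhat w₀ w₃ t z)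
      = (tdot : ℂ) - ((herm zdot z).im : ℂ) := by
  have hre : herm zdot z + herm z zdot = 2 * ((herm zdot z).re : ℂ) := by
    rw [← herm_conj zdot z, Complex.add_conj]; push_cast; ring
  constructor
  · have key : (fun s : ℝ => Qhat w₀ w₃ (t + s * tdot) (z + s • zdot)) =
        fun s : ℝ => Qhat w₀ w₃ t z
          + s • (zdot + ((tdot : ℂ) - Complex.I * ((herm zdot z).re : ℂ)) • w₃)
          + (s ^ 2) • (-(Complex.I / 2 * herm zdot zdot) • w₃) := by
      funext s
      have hs : s • zdot = (s : ℂ) • zdot := by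
        ext i; simp
      have hq : herm (z + s • zdot) (z + s • zdot) = herm z z
          + s * (2 * ((herm zdot z).re : ℂ)) + s ^ 2 * herm zdot zdot := by
        rw [← hre, hs]
        simp only [herm_add_left, herm_add_right, herm_smul_left, herm_smul_right,
          Complex.conj_ofReal]
        ring
      ext i
      simp only [Qhat, hq, Pi.add_apply, Pi.sub_apply, Pi.smul_apply, smul_eq_mul,
        Complex.real_smul]
      push_cast
      ring
    rw [key]
    have h1 := (hasDerivAt_id (0 : ℝ)).smul_const
      (zdot + ((tdot : ℂ) - Complex.I * ((herm zdot z).re : ℂ)) • w₃)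
    have h2 := (hasDerivAt_pow 2 (0 : ℝ)).smul_const
      (-(Complex.I / 2 * herm zdot zdot) • w₃)
    have h3 := (h1.const_add (Qhat w₀ w₃ t z)).add h2
    refine h3.congr_deriv ?_
    simp
  · have h30 : herm w₃ w₀ = -Complex.I := by rw [← herm_conj, h₀₃, Complex.conj_I]
    have h3z : herm w₃ z = 0 := by rw [← herm_conj, hz₃, map_zero]
    have hQ : Qhat w₀ w₃ t z = z + w₀ + ((t : ℂ) - Complex.I / 2 * herm z z) • w₃ := by
      rw [Qhat, sub_smul]; abel
    rw [hQ]
    simp only [herm_add_left, herm_add_right, herm_smul_left, herm_smul_right,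
      h30, h3z, h₃, hzdot₀, hzdot₃]
    have e := Complex.re_add_im (herm zdot z)
    linear_combination (-Complex.I) * e + (((herm zdot z).im : ℂ) - tdot
      + Complex.I * ((herm zdot z).re : ℂ)) * Complex.I_sq
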